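/- arXiv:2409.04546 — 6 statements merged into one kernel-verified Lean document; each statement's English description precedes it below -/
import Mathlib

section
/- Let (h,[·,·]_h,Θ,B_h) be a quadratic Hom-Lie algebra over F with twist map Θ in the centroid, let (s,[·,·]_s) be a Lie algebra over F with dual space s*, and define the coadjoint action ad*(x)(β)(z) = −β([x,z]_s). Suppose there are linear maps φ: s → h, ϕ: s → s*, ρ: s → End(h) with each ρ(x) skew-symmetric with respect to B_h, τ: s → Hom(h, s*), and a skew-symmetric bilinear map μ: s × s → s*, satisfying: (A) ϕ(x)(y) = ϕ(y)(x) for all x,y in s; (B) Θ∘ρ(x) = [φ(x),·]_h = ρ(x)∘Θ and this map is a derivation of (h,[·,·]_h), for all x in s; (C) φ([x,y]_s) = ρ(x)(φ(y)) for all x,y in s; (D) ϕ([x,y]_s) = ad*(x)(ϕ(y)) for all x,y in s; (E) each ρ(x) maps Im(Θ) into Im(Θ), ρ(x)([u,v]_h) = [ρ(x)(u),v]_h + [u,ρ(x)(v)]_h for all u,v in Im(Θ), and ρ([x,y]_s)(u) = ρ(x)(ρ(y)(u)) − ρ(y)(ρ(x)(u)) for all u in Im(Θ); (F) τ(x)∘Θ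 = 0, τ(x)∘φ = 0, and τ(x)(u)(x) = 0 for all x in s and u in h; (G) μ(x,y)(z) = μ(y,z)(x) for all x,y,z in s. Define L: h → s* by L(u)(x) = B_h(u,φ(x)); let λ: s × s → h be the unique bilinear map with B_h(λ(x,y),u) = −τ(x)(u)(y) for all u in h; define γ: h × h → s* by γ(u,v)(x) = B_h(ρ(x)(u),v). On g = s × h × s* define T(x,u,α) = (0, φ(x)+Θ(u), ϕ(x)+L(u)), the bracket [(x,u,α),(y,v,β)] = ([x,y]_s, λ(x,y)+ρ(x)(v)−ρ(y)(u)+[u,v]_h, μ(x,y)+τ(x)(v)−τ(y)(u)+γ(u,v)+ad*(x)(β)−ad*(y)(α)), and B((x,u,α),(y,v,β)) = α(y)+β(x)+B_h(u,v). Then (g,[·,·],T,B) is a quadratic Hom-Lie algebra with twist map T in the centroid; that is: the bracket is bilinear and skew-symmetric, the Hom-Jacobi identity holds for (the bracket, T), T([X,Y]) = [T(X),Y] for all X,Y in g, B is a nondegenerate symmetric bilinear form, B is invariant under the bracket, and T is self-adjoint with respect to B. -/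
/-- Double extension construction: from a quadratic Hom-Lie algebra `(H, brH, Θ, BH)`
with twist map in the centroid, a Lie algebra `(S, brS)`, and maps
`φ, ϕ, ρ, τ, μ` satisfying conditions (A)–(G), the space `g = S × H × S*` equipped
with the indicated bracket, twist map and bilinear form is a quadratic Hom-Lie
algebra with twist map in the centroid. -/
theorem double_extension
    (F : Type*) [Field F] [CharZero F]
    (H : Type*) [AddCommGroup H] [Module F H] [FiniteDimensional F H]
    (S : Type*) [AddCommGroup S] [Module F S] [FiniteDimensional F S]
    -- quadratic Hom-Lie algebra structure on H with twist map Θ in the centroid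
    (brH : H →ₗ[F] H →ₗ[F] H) (Θ : H →ₗ[F] H) (BH : LinearMap.BilinForm F H)
    (hH_skew : ∀ u v : H, brH u v = - brH v u)
    (hH_jac : ∀ u v w : H,
      brH (Θ u) (brH v w) + brH (Θ v) (brH w u) + brH (Θ w) (brH u v) = 0)
    (hH_cent : ∀ u v : H, Θ (brH u v) = brH (Θ u) v)
    (hBH_symm : ∀ u v : H, BH u v = BH v u)
    (hBH_nondeg : ∀ u : H, (∀ v : H, BH u v = 0) → u = 0)
    (hBH_inv : ∀ u v w : H, BH u (brH v w) = BH (brH u v) w)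
    (hBH_selfadj : ∀ u v : H, BH (Θ u) v = BH u (Θ v))
    -- Lie algebra structure on S
    (brS : S →ₗ[F] S →ₗ[F] S)
    (hS_skew : ∀ x y : S, brS x y = - brS y x)
    (hS_jac : ∀ x y z : S, brS x (brS y z) + brS y (brS z x) + brS z (brS x y) = 0)
    -- the linear maps φ, ϕ, ρ, τ and the bilinear map μ
    (φ : S →ₗ[F] H) (ϕ : S →ₗ[F] Module.Dual F S)
    (ρ : S →ₗ[F] H →ₗ[F] H) (τ : S →ₗ[F] H →ₗ[F] Module.Dual F S)
    (μ : S →ₗ[F] S →ₗ[F] Module.Dual F S)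
    (hρ_skew : ∀ (x : S) (u v : H), BH (ρ x u) v = - BH u (ρ x v))
    (hμ_skew : ∀ x y : S, μ x y = - μ y x)
    -- (A)
    (hA : ∀ x y : S, ϕ x y = ϕ y x)
    -- (B)
    (hB1 : ∀ (x : S) (u : H), Θ (ρ x u) = brH (φ x) u)
    (hB2 : ∀ (x : S) (u : H), ρ x (Θ u) = brH (φ x) u)
    (hB3 : ∀ (x : S) (u v : H),
      brH (φ x) (brH u v) = brH (brH (φ x) u) v + brH u (brH (φ x) v))
    -- (C)
    (hC : ∀ x y : S, φ (brS x y) = ρ x (φ y))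
    -- (D): ϕ([x,y]) = ad*(x)(ϕ(y)), where ad*(x)(β)(z) = −β([x,z])
    (hD : ∀ x y z : S, ϕ (brS x y) z = - ϕ y (brS x z))
    -- (E)
    (hE1 : ∀ x : S, ∀ w ∈ LinearMap.range Θ, ρ x w ∈ LinearMap.range Θ)
    (hE2 : ∀ x : S, ∀ u ∈ LinearMap.range Θ, ∀ v ∈ LinearMap.range Θ,
      ρ x (brH u v) = brH (ρ x u) v + brH u (ρ x v))
    (hE3 : ∀ x y : S, ∀ u ∈ LinearMap.range Θ,
      ρ (brS x y) u = ρ x (ρ y u) - ρ y (ρ x u))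
    -- (F)
    (hF1 : ∀ (x : S) (u : H), τ x (Θ u) = 0)
    (hF2 : ∀ x y : S, τ x (φ y) = 0)
    (hF3 : ∀ (x : S) (u : H), τ x u x = 0)
    -- (G)
    (hG : ∀ x y z : S, μ x y z = μ y z x)
    -- L(u)(x) = BH(u, φ(x)); λ is determined by BH(λ(x,y), u) = −τ(x)(u)(y);
    -- γ(u,v)(x) = BH(ρ(x)(u), v)
    (lam : S → S → H)
    (hlam : ∀ (x y : S) (u : H), BH (lam x y) u = - τ x u y)
    -- the structure maps on g = S × H × S*
    (brG : (S × H × Module.Dual F S) → (S × H × Module.Dual F S) →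
      (S × H × Module.Dual F S))
    (Tg : (S × H × Module.Dual F S) → (S × H × Module.Dual F S))
    (BG : (S × H × Module.Dual F S) → (S × H × Module.Dual F S) → F)
    (hbrG : ∀ (x y : S) (u v : H) (α β : Module.Dual F S),
      (brG (x, u, α) (y, v, β)).1 = brS x y ∧
      (brG (x, u, α) (y, v, β)).2.1 = lam x y + ρ x v - ρ y u + brH u v ∧
      (∀ z : S, (brG (x, u, α) (y, v, β)).2.2 z
        = μ x y z + τ x v z - τ y u z + BH (ρ z u) v - β (brS x z) + α (brS y z)))
    (hTg : ∀ (x : S) (u : H) (α : Module.Dual F S),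
      (Tg (x, u, α)).1 = 0 ∧
      (Tg (x, u, α)).2.1 = φ x + Θ u ∧
      (∀ z : S, (Tg (x, u, α)).2.2 z = ϕ x z + BH u (φ z)))
    (hBG : ∀ (x y : S) (u v : H) (α β : Module.Dual F S),
      BG (x, u, α) (y, v, β) = α y + β x + BH u v) :
    -- (g, brG, Tg, BG) is a quadratic Hom-Lie algebra with twist map in the centroid
    (∀ X, IsLinearMap F (brG X)) ∧
    (∀ Y, IsLinearMap F (fun X => brG X Y)) ∧
    (∀ X Y, brG X Y = - brG Y X) ∧
    (∀ X Y Z, brG (Tg X) (brG Y Z) + brG (Tg Y) (brG Z X) + brG (Tg Z) (brG X Y) = 0) ∧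
    (∀ X Y, Tg (brG X Y) = brG (Tg X) Y) ∧
    IsLinearMap F Tg ∧
    (∀ X, IsLinearMap F (BG X)) ∧
    (∀ Y, IsLinearMap F (fun X => BG X Y)) ∧
    (∀ X Y, BG X Y = BG Y X) ∧
    (∀ X, (∀ Y, BG X Y = 0) → X = 0) ∧
    (∀ X Y Z, BG X (brG Y Z) = BG (brG X Y) Z) ∧
    (∀ X Y, BG (Tg X) Y = BG X (Tg Y)) := by
  have hBH_ext : ∀ a b : H, (∀ t, BH a t = BH b t) → a = b := fun a b h =>
    sub_eq_zero.mp (hBH_nondeg _ fun t => by simp [h t])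
  -- consequences for `lam`
  have hτ_skew : ∀ (x y : S) (u : H), τ x u y = - τ y u x := fun x y u => by
    have h := hF3 (x + y) u
    simp only [map_add, LinearMap.add_apply, hF3] at h
    linear_combination h
  have hlam_add_left : ∀ x x' y, lam (x + x') y = lam x y + lam x' y := fun x x' y =>
    hBH_ext _ _ fun t => by simp [hlam]; ring
  have hlam_add_right : ∀ x y y', lam x (y + y') = lam x y + lam x y' := fun x y y' =>
    hBH_ext _ _ fun t => by simp [hlam]; ring
  have hlam_smul_left : ∀ (c : F) x y, lam (c • x) y = c • lam x y := fun c x y =>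
    hBH_ext _ _ fun t => by simp [hlam]
  have hlam_smul_right : ∀ (c : F) x y, lam x (c • y) = c • lam x y := fun c x y =>
    hBH_ext _ _ fun t => by simp [hlam]
  have hlam_zero_left : ∀ y, lam 0 y = 0 := fun y => by
    simpa using hlam_smul_left 0 0 y
  have hlam_skew : ∀ x y, lam x y = - lam y x := fun x y =>
    hBH_ext _ _ fun t => by simp [hlam, hτ_skew x y]
  have hΘ_lam : ∀ x y, Θ (lam x y) = 0 := fun x y =>
    hBH_nondeg _ fun t => by simp [hBH_selfadj, hlam, hF1]
  -- consequences of the compatibility conditions on `H`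
  have hΘρ : ∀ x u, Θ (ρ x u) = ρ x (Θ u) := fun x u => (hB1 x u).trans (hB2 x u).symm
  have hcent_right : ∀ u v, Θ (brH u v) = brH u (Θ v) := fun u v => by
    rw [hH_skew u v, map_neg, hH_cent, hH_skew u]
  have hρ_bracket : ∀ x y u,
      brH (φ (brS x y)) u = brH (φ x) (ρ y u) - brH (φ y) (ρ x u) := fun x y u => by
    rw [← hB2, ← hB2, ← hB2, hE3 x y _ ⟨u, rfl⟩, hΘρ, hΘρ]
  -- the components of the structure maps on `g`
  have br_fst : ∀ X Y, (brG X Y).1 = brS X.1 Y.1 := fun X Y => (hbrG _ _ _ _ _ _).1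
  have br_mid : ∀ X Y, (brG X Y).2.1
      = lam X.1 Y.1 + ρ X.1 Y.2.1 - ρ Y.1 X.2.1 + brH X.2.1 Y.2.1 :=
    fun X Y => (hbrG _ _ _ _ _ _).2.1
  have br_dual : ∀ X Y z, (brG X Y).2.2 z
      = μ X.1 Y.1 z + τ X.1 Y.2.1 z - τ Y.1 X.2.1 z + BH (ρ z X.2.1) Y.2.1
        - Y.2.2 (brS X.1 z) + X.2.2 (brS Y.1 z) :=
    fun X Y => (hbrG _ _ _ _ _ _).2.2
  have T_fst : ∀ X, (Tg X).1 = 0 := fun X => (hTg _ _ _).1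
  have T_mid : ∀ X, (Tg X).2.1 = φ X.1 + Θ X.2.1 := fun X => (hTg _ _ _).2.1
  have T_dual : ∀ X z, (Tg X).2.2 z = ϕ X.1 z + BH X.2.1 (φ z) := fun X => (hTg _ _ _).2.2
  have BG_apply : ∀ X Y, BG X Y = X.2.2 Y.1 + Y.2.2 X.1 + BH X.2.1 Y.2.1 :=
    fun X Y => hBG _ _ _ _ _ _
  have g_ext : ∀ X Y : S × H × Module.Dual F S,
      X.1 = Y.1 → X.2.1 = Y.2.1 → (∀ z, X.2.2 z = Y.2.2 z) → X = Y :=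
    fun X Y h₁ h₂ h₃ => Prod.ext h₁ (Prod.ext h₂ (LinearMap.ext h₃))
  -- the bracket with an element in the image of the twist map
  have brT_mid : ∀ X W, (brG (Tg X) W).2.1
      = φ (brS X.1 W.1) - brH (φ W.1) X.2.1 + brH (φ X.1) W.2.1 + Θ (brH X.2.1 W.2.1) :=
    fun X W => by
      simp only [br_mid, T_fst, T_mid, hlam_zero_left, map_add, map_zero, LinearMap.zero_apply,
        LinearMap.add_apply, ← hC, hB2, hH_cent, hS_skew W.1 X.1, map_neg]
      module
  have brT_dual : ∀ X W s, (brG (Tg X) W).2.2 s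
      = BH (φ (brS s X.1)) W.2.1 + BH (ρ s (Θ X.2.1)) W.2.1
        + ϕ X.1 (brS W.1 s) + BH X.2.1 (φ (brS W.1 s)) :=
    fun X W s => by
      simp only [br_dual, T_fst, T_mid, T_dual, map_add, map_zero, LinearMap.zero_apply,
        LinearMap.add_apply, ← hC, hF1, hF2]
      ring
  refine ⟨fun X => ⟨fun Y Z => ?_, fun c Y => ?_⟩, fun X => ⟨fun Y Z => ?_, fun c Y => ?_⟩,
    fun X Y => ?_, fun X Y Z => ?_, fun X Y => ?_, ⟨fun X Y => ?_, fun c X => ?_⟩,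
    fun X => ⟨fun Y Z => ?_, fun c Y => ?_⟩, fun X => ⟨fun Y Z => ?_, fun c Y => ?_⟩,
    fun X Y => ?_, fun X h => ?_, fun X Y Z => ?_, fun X Y => ?_⟩
  · refine g_ext _ _ ?_ ?_ fun z => ?_ <;> simp [br_fst, br_mid, br_dual, hlam_add_right]
    · module
    · ring
  · refine g_ext _ _ ?_ ?_ fun z => ?_ <;> simp [br_fst, br_mid, br_dual, hlam_smul_right]
    · module
    · ring
  · refine g_ext _ _ ?_ ?_ fun z => ?_ <;> simp [br_fst, br_mid, br_dual, hlam_add_left]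
    · module
    · ring
  · refine g_ext _ _ ?_ ?_ fun z => ?_ <;> simp [br_fst, br_mid, br_dual, hlam_smul_left]
    · module
    · ring
  · -- skew-symmetry
    refine g_ext _ _ ?_ ?_ fun z => ?_
    · simpa [br_fst] using hS_skew _ _
    · simp only [br_mid, Prod.snd_neg, Prod.fst_neg, hlam_skew X.1, hH_skew X.2.1]
      module
    · simp only [br_dual, Prod.snd_neg, LinearMap.neg_apply, hμ_skew X.1, hρ_skew z X.2.1,
        hBH_symm X.2.1]
      ring
  · -- Hom-Jacobi identity
    obtain ⟨x, u, α⟩ := X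
    obtain ⟨y, v, β⟩ := Y
    obtain ⟨z, w, δ⟩ := Z
    have hφlam : ∀ a b c, brH (φ a) (lam b c) = 0 := fun a b c => by
      rw [← hB2, hΘ_lam, map_zero]
    have hΘbrlam : ∀ a b c, Θ (brH a (lam b c)) = 0 := fun a b c => by
      rw [hcent_right, hΘ_lam, map_zero]
    refine g_ext _ _ ?_ ?_ fun s => ?_
    · simp [br_fst, T_fst]
    · have mixed : ∀ a p q, brH (φ a) (brH p q) - Θ (brH p (ρ a q)) + Θ (brH q (ρ a p)) = 0 :=
        fun a p q => by
          rw [hcent_right, hcent_right, hB1, hB1, hB3, hH_skew q]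
          abel
      have hjac := congrArg φ (hS_jac x y z)
      have hΘjac := hH_jac u v w
      simp only [← hH_cent] at hΘjac
      simp only [map_add, map_zero] at hjac
      simp only [Prod.snd_add, Prod.fst_add, Prod.snd_zero, Prod.fst_zero, brT_mid, br_fst, br_mid,
        map_add, map_sub, hφlam, hΘbrlam]
      linear_combination (norm := module) hjac + hΘjac + mixed x v w + mixed y w u + mixed z u v
        - hρ_bracket x y w - hρ_bracket y z u - hρ_bracket z x v
    · have hφBlam : ∀ a b c, BH (φ a) (lam b c) = 0 := fun a b c => by
        rw [hBH_symm, hlam, hF2]; simp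
      have hΘBlam : ∀ a p b c, BH (ρ a (Θ p)) (lam b c) = 0 := fun a p b c => by
        rw [← hΘρ, hBH_selfadj, hΘ_lam, map_zero]
      have hϕ : ϕ x (brS (brS y z) s) + ϕ y (brS (brS z x) s) + ϕ z (brS (brS x y) s) = 0 := by
        have h := congrArg (fun t => ϕ t s) (hS_jac x y z)
        simp only [hS_skew _ (brS _ _), map_add, map_neg, map_zero, LinearMap.add_apply,
          LinearMap.neg_apply, LinearMap.zero_apply, hD (brS _ _)] at h
        linear_combination h
      have one : ∀ a b p, BH (φ (brS s a)) (ρ b p) - BH (φ (brS s b)) (ρ a p)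
          + BH p (φ (brS (brS a b) s)) = 0 := fun a b p => by
        have h := congrArg (fun t => BH (φ t) p) (hS_jac a b s)
        have h₁ := hρ_skew b (φ (brS s a)) p
        have h₂ := hρ_skew a (φ (brS s b)) p
        simp only [← hC] at h₁ h₂
        rw [hBH_symm p, hS_skew (brS a b)]
        simp only [hS_skew b s, map_add, map_neg, map_zero, LinearMap.add_apply,
          LinearMap.neg_apply, LinearMap.zero_apply] at h ⊢
        linear_combination -h + h₁ - h₂
      have two : ∀ a p q, BH (φ (brS s a)) (brH p q) - BH (ρ s (Θ p)) (ρ a q)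
          + BH (ρ s (Θ q)) (ρ a p) = 0 := fun a p q => by
        have h₁ := hρ_skew a (ρ s (Θ p)) q
        have h₂ : BH (ρ s (Θ q)) (ρ a p) = - BH (ρ s (ρ a (Θ p))) q := by
          rw [← hΘρ, hBH_selfadj, hΘρ, hρ_skew, hBH_symm]
        rw [hBH_inv, ← hB2, hE3 s a _ ⟨p, rfl⟩, h₂, map_sub, LinearMap.sub_apply]
        linear_combination -h₁
      have three : BH (ρ s (Θ u)) (brH v w) + BH (ρ s (Θ v)) (brH w u)
          + BH (ρ s (Θ w)) (brH u v) = 0 := by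
        have h₁ : BH (brH (φ s) w) (brH u v) = - BH (brH (φ s) (brH u v)) w := by
          rw [hH_skew (φ s) w, map_neg, LinearMap.neg_apply, ← hBH_inv, hBH_symm]
        have h₂ : BH (brH (φ s) v) (brH w u) = BH (brH u (brH (φ s) v)) w := by
          rw [hH_skew w, map_neg, hBH_inv, hH_skew _ u, map_neg, LinearMap.neg_apply, neg_neg]
        rw [hB2, hB2, hB2, h₁, h₂, hBH_inv, hB3, map_add, LinearMap.add_apply]
        ring
      simp only [Prod.snd_add, Prod.snd_zero, LinearMap.add_apply, LinearMap.zero_apply, brT_dual,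
        br_fst, br_mid, map_add, map_sub, hφBlam, hΘBlam]
      linear_combination hϕ + one x y w + one y z u + one z x v + two x v w + two y w u
        + two z u v + three
  · -- the twist map is in the centroid
    refine g_ext _ _ ?_ ?_ fun s => ?_
    · simp [br_fst, T_fst]
    · rw [brT_mid, T_mid, br_fst, br_mid]
      simp only [map_add, map_sub, hΘ_lam, hB1]
      module
    · have h₁ : BH (brH X.2.1 Y.2.1) (φ s) = BH (ρ s (Θ X.2.1)) Y.2.1 := by
        rw [hBH_symm, hBH_inv, hB2]
      have h₂ : ϕ (brS X.1 Y.1) s = ϕ X.1 (brS Y.1 s) := by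
        rw [hS_skew, map_neg, LinearMap.neg_apply, hD, neg_neg]
      have h₃ : BH (φ (brS s X.1)) Y.2.1 = BH (ρ X.1 Y.2.1) (φ s) := by
        rw [hρ_skew, ← hC, hS_skew s, map_neg, map_neg, LinearMap.neg_apply, hBH_symm]
      have h₄ : BH (ρ Y.1 X.2.1) (φ s) = - BH X.2.1 (φ (brS Y.1 s)) := by
        rw [hρ_skew, hC]
      rw [brT_dual, T_dual, br_fst, br_mid]
      simp only [map_add, map_sub, LinearMap.add_apply, LinearMap.sub_apply, hlam, hF2,
        LinearMap.zero_apply, h₁, h₂, h₃, h₄]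
      ring
  · refine g_ext _ _ ?_ ?_ fun z => ?_ <;> simp [T_fst, T_mid, T_dual]
    · module
    · ring
  · refine g_ext _ _ ?_ ?_ fun z => ?_ <;> simp [T_fst, T_mid, T_dual]
    ring
  · simp [BG_apply]; ring
  · simp [BG_apply]; ring
  · simp [BG_apply]; ring
  · simp [BG_apply]; ring
  · rw [BG_apply, BG_apply, hBH_symm]; ring
  · -- nondegeneracy
    refine g_ext _ _ ?_ (hBH_nondeg _ fun t => ?_) fun z => ?_
    · refine (Module.forall_dual_apply_eq_zero_iff F _).mp fun f => ?_
      simpa [BG_apply] using h (0, 0, f)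
    · simpa [BG_apply] using h (0, t, 0)
    · simpa [BG_apply] using h (z, 0, 0)
  · -- invariance
    obtain ⟨x, u, α⟩ := X
    obtain ⟨y, v, β⟩ := Y
    obtain ⟨z, w, δ⟩ := Z
    have h₁ : BH u (ρ y w) = - BH (ρ y u) w := by rw [hρ_skew, neg_neg]
    have h₂ : BH u (ρ z v) = - BH (ρ z u) v := by rw [hρ_skew, neg_neg]
    simp only [BG_apply, br_fst, br_mid, br_dual, map_add, map_sub, LinearMap.add_apply,
      LinearMap.sub_apply, hBH_symm u (lam _ _), hlam, hBH_inv, h₁, h₂, hG x y z,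
      hτ_skew x, hS_skew y x, hS_skew z x, map_neg]
    ring
  · rw [BG_apply, BG_apply, T_fst, T_fst, T_mid, T_mid, T_dual, T_dual]
    simp only [map_add, map_zero, LinearMap.add_apply, hA X.1, hBH_selfadj, hBH_symm (φ _)]
    ring
end

section
/- Let (g,[·,·],T) be a Hom-Lie algebra over F with twist map T in the centroid. Then there exists a natural number ℓ ≥ 1 such that g = Im(T^ℓ) ⊕ Ker(T^ℓ) as a direct sum of subspaces, both Im(T^ℓ) and Ker(T^ℓ) are ideals of g, the bracket restricted to Im(T^ℓ) satisfies the Jacobi identity ([a,[b,c]] + [b,[c,a]] + [c,[a,b]] = 0 for all a,b,c in Im(T^ℓ)), and the restriction of T to Ker(T^ℓ) is nilpotent. -/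
/-- Powers of a centroid element of a skew-symmetric bracket commute with left multiplications. -/
theorem pow_apply_bracket {R M : Type*} [CommRing R] [AddCommGroup M] [Module R M]
    {br : M →ₗ[R] M →ₗ[R] M} {T : M →ₗ[R] M}
    (hskew : ∀ x y : M, br x y = - br y x)
    (hcent : ∀ x y : M, T (br x y) = br (T x) y) (n : ℕ) (x y : M) :
    (T ^ n) (br x y) = br x ((T ^ n) y) := by
  induction n with
  | zero => simp
  | succ n ih =>
    rw [pow_succ', Module.End.mul_apply, Module.End.mul_apply, ih, hskew, map_neg, hcent,
      ← hskew]

/-- Fitting decomposition of a Hom-Lie algebra with twist map in the centroid: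
`g = Im(T^ℓ) ⊕ Ker(T^ℓ)`, both summands are ideals, the bracket restricted to
`Im(T^ℓ)` satisfies the Jacobi identity, and `T` restricted to `Ker(T^ℓ)` is nilpotent. -/
theorem fitting_decomposition
    (F : Type*) [Field F] [CharZero F]
    (V : Type*) [AddCommGroup V] [Module F V] [FiniteDimensional F V]
    (br : V →ₗ[F] V →ₗ[F] V) (T : V →ₗ[F] V)
    (hskew : ∀ x y : V, br x y = - br y x)
    (hhomjac : ∀ x y z : V,
      br (T x) (br y z) + br (T y) (br z x) + br (T z) (br x y) = 0)
    (hcent : ∀ x y : V, T (br x y) = br (T x) y) :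
    ∃ ℓ : ℕ, 1 ≤ ℓ ∧
      IsCompl (LinearMap.range (T ^ ℓ)) (LinearMap.ker (T ^ ℓ)) ∧
      ((∀ v ∈ LinearMap.range (T ^ ℓ), T v ∈ LinearMap.range (T ^ ℓ)) ∧
        (∀ x : V, ∀ v ∈ LinearMap.range (T ^ ℓ), br x v ∈ LinearMap.range (T ^ ℓ))) ∧
      ((∀ v ∈ LinearMap.ker (T ^ ℓ), T v ∈ LinearMap.ker (T ^ ℓ)) ∧
        (∀ x : V, ∀ v ∈ LinearMap.ker (T ^ ℓ), br x v ∈ LinearMap.ker (T ^ ℓ))) ∧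
      (∀ a ∈ LinearMap.range (T ^ ℓ), ∀ b ∈ LinearMap.range (T ^ ℓ),
        ∀ c ∈ LinearMap.range (T ^ ℓ),
          br a (br b c) + br b (br c a) + br c (br a b) = 0) ∧
      (∃ n : ℕ, ∀ v ∈ LinearMap.ker (T ^ ℓ), (T ^ n) v = 0) := by
  obtain ⟨ℓ, hcompl, hℓ⟩ :=
    (T.eventually_isCompl_ker_pow_range_pow.and (Filter.eventually_ge_atTop 1)).exists
  have hpow := pow_apply_bracket hskew hcent ℓ
  have hcomm (v : V) : (T ^ ℓ) (T v) = T ((T ^ ℓ) v) := by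
    rw [← Module.End.mul_apply, ← Module.End.mul_apply, pow_mul_comm']
  have hrange (x v : V) (hv : v ∈ LinearMap.range (T ^ ℓ)) :
      br x v ∈ LinearMap.range (T ^ ℓ) := by
    obtain ⟨w, rfl⟩ := hv
    exact ⟨br x w, hpow x w⟩
  refine ⟨ℓ, hℓ, hcompl.symm, ⟨?_, hrange⟩, ⟨?_, ?_⟩, ?_, ℓ, fun v hv => hv⟩
  · rintro _ ⟨w, rfl⟩
    exact ⟨T w, hcomm w⟩
  · intro v hv
    rw [LinearMap.mem_ker] at hv ⊢
    rw [hcomm, hv, map_zero]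
  · intro x v hv
    rw [LinearMap.mem_ker] at hv ⊢
    rw [hpow, hv, map_zero]
  · intro a ha b hb c hc
    refine Submodule.disjoint_def.mp hcompl.disjoint _ ?_
      (add_mem (add_mem (hrange _ _ (hrange _ _ hc)) (hrange _ _ (hrange _ _ ha)))
        (hrange _ _ (hrange _ _ hb)))
    have hT : T (br a (br b c) + br b (br c a) + br c (br a b)) = 0 := by
      simp only [map_add, hcent, hhomjac]
    rw [LinearMap.mem_ker, ← Nat.sub_add_cancel hℓ, pow_succ, Module.End.mul_apply, hT, map_zero]
end

section
/- Let (g,[·,·],T,B) be a quadratic Hom-Lie algebra over F with nilpotent twist map T in the centroid, let I be a proper ideal of g with Ker(T) + Im(T) ⊆ I and I^⊥ ⊆ I (where I^⊥ is the B-orthogonal complement of I), and let h be a subspace with I = h ⊕ I^⊥. Let π: I → h be the projection onto h along I^⊥, and define Θ: h → h by Θ(u) = π(T(u)) and [u,v]_h := π([u,v]) for u,v in h. Then: (1) the restriction of B to h × h is nondegenerate; (2) Θ is nilpotent; (3) Θ([u,v]_h) = [Θ(u),v]_h for all u,v in h (Θ is in the centroid); (4) the Hom-Jacobi identity holds: [Θ(u),[v,w]_h]_h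 + [Θ(v),[w,u]_h]_h + [Θ(w),[u,v]_h]_h = 0 for all u,v,w in h; (5) B(Θ(u),v) = B(u,Θ(v)) for all u,v in h; (6) B(u,[v,w]_h) = B([u,v]_h,w) for all u,v,w in h. That is, (h,[·,·]_h,Θ,B|_{h×h}) is a quadratic Hom-Lie algebra with nilpotent twist map Θ in the centroid. -/
/-- If `I` is a proper ideal containing `Ker T + Im T` with `I^⊥ ⊆ I` and
`I = h ⊕ I^⊥`, then `(h, [·,·]_h, Θ, B|_{h×h})` is a quadratic Hom-Lie algebra
with nilpotent twist map `Θ = π ∘ T` in the centroid, where `π : I → h` is the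
projection along `I^⊥`. -/
theorem h_quadratic_homLie
    (F : Type*) [Field F] [CharZero F]
    (V : Type*) [AddCommGroup V] [Module F V] [FiniteDimensional F V]
    (br : V →ₗ[F] V →ₗ[F] V) (T : V →ₗ[F] V) (B : LinearMap.BilinForm F V)
    (hskew : ∀ x y : V, br x y = - br y x)
    (hhomjac : ∀ x y z : V,
      br (T x) (br y z) + br (T y) (br z x) + br (T z) (br x y) = 0)
    (hcent : ∀ x y : V, T (br x y) = br (T x) y)
    (hBsymm : ∀ x y : V, B x y = B y x)
    (hBnondeg : ∀ x : V, (∀ y : V, B x y = 0) → x = 0)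
    (hBinv : ∀ x y z : V, B x (br y z) = B (br x y) z)
    (hBselfadj : ∀ x y : V, B (T x) y = B x (T y))
    (hnil : ∃ n : ℕ, T ^ n = 0)
    (I : Submodule F V)
    (hI : (∀ v ∈ I, T v ∈ I) ∧ (∀ x : V, ∀ v ∈ I, br x v ∈ I))
    (hker : ∀ x : V, T x = 0 → x ∈ I)
    (him : ∀ x : V, T x ∈ I)
    (hproper : I ≠ ⊤)
    (hperp : LinearMap.BilinForm.orthogonal B I ≤ I)
    (h : Submodule F V)
    (hsup : h ⊔ LinearMap.BilinForm.orthogonal B I = I)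
    (hinf : h ⊓ LinearMap.BilinForm.orthogonal B I = ⊥)
    (π : V →ₗ[F] V)
    (hπ : ∀ u ∈ I, π u ∈ h ∧ u - π u ∈ LinearMap.BilinForm.orthogonal B I) :
    -- (1) B restricted to h is nondegenerate
    (∀ u ∈ h, (∀ v ∈ h, B u v = 0) → u = 0) ∧
    -- (2) Θ = π ∘ T is nilpotent on h
    (∃ n : ℕ, ∀ u ∈ h, (fun v : V => π (T v))^[n] u = 0) ∧
    -- (3) Θ is in the centroid of [·,·]_h
    (∀ u ∈ h, ∀ v ∈ h, π (T (π (br u v))) = π (br (π (T u)) v)) ∧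
    -- (4) Hom-Jacobi identity for ([·,·]_h, Θ)
    (∀ u ∈ h, ∀ v ∈ h, ∀ w ∈ h,
      π (br (π (T u)) (π (br v w))) + π (br (π (T v)) (π (br w u)))
        + π (br (π (T w)) (π (br u v))) = 0) ∧
    -- (5) Θ is self-adjoint for B|_{h×h}
    (∀ u ∈ h, ∀ v ∈ h, B (π (T u)) v = B u (π (T v))) ∧
    -- (6) B|_{h×h} is invariant under [·,·]_h
    (∀ u ∈ h, ∀ v ∈ h, ∀ w ∈ h, B u (π (br v w)) = B (π (br u v)) w) := by
  obtain ⟨hIT, hIbr⟩ := hI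
  have orth : ∀ x, x ∈ LinearMap.BilinForm.orthogonal B I ↔ ∀ y ∈ I, B y x = 0 :=
    fun _ => LinearMap.BilinForm.mem_orthogonal_iff
  set J := LinearMap.BilinForm.orthogonal B I
  have hh : ∀ u ∈ h, u ∈ I := fun u hu => hsup ▸ Submodule.mem_sup_left hu
  have hdisj : ∀ u ∈ h, u ∈ J → u = 0 := fun u hu hu' =>
    (Submodule.mem_bot F).1 (hinf ▸ Submodule.mem_inf.2 ⟨hu, hu'⟩)
  have hπJ : ∀ u ∈ J, π u = 0 := fun u hu => by
    obtain ⟨h₁, h₂⟩ := hπ u (hperp hu)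
    exact hdisj _ h₁ (by simpa using J.sub_mem hu h₂)
  have hπh : ∀ u ∈ h, π u = u := fun u hu => by
    obtain ⟨h₁, h₂⟩ := hπ u (hh u hu)
    exact (sub_eq_zero.1 (hdisj _ (h.sub_mem hu h₁) h₂)).symm
  have hJT : ∀ u ∈ J, T u ∈ J := fun u hu => (orth _).2 fun y hy => by
    rw [← hBselfadj]
    exact (orth u).1 hu _ (hIT y hy)
  have hIbr' : ∀ v ∈ I, ∀ x, br v x ∈ I := fun v hv x => by
    rw [hskew]
    exact I.neg_mem (hIbr x v hv)
  have hJbr : ∀ x, ∀ u ∈ J, br x u ∈ J := fun x u hu => (orth _).2 fun y hy => by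
    rw [hBinv]
    exact (orth u).1 hu _ (hIbr' y hy x)
  have hJbr' : ∀ u ∈ J, ∀ x, br u x ∈ J := fun u hu x => by
    rw [hskew]
    exact J.neg_mem (hJbr x u hu)
  have hπT : ∀ x ∈ I, π (T (π x)) = π (T x) := fun x hx => by
    have := hπJ _ (hJT _ (hπ x hx).2)
    rw [map_sub, map_sub, sub_eq_zero] at this
    exact this.symm
  have hπbr_right : ∀ x, ∀ y ∈ I, π (br x (π y)) = π (br x y) := fun x y hy => by
    have := hπJ _ (hJbr x _ (hπ y hy).2)
    rw [map_sub, map_sub, sub_eq_zero] at this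
    exact this.symm
  have hπbr_left : ∀ x ∈ I, ∀ y, π (br (π x) y) = π (br x y) := fun x hx y => by
    have := hπJ _ (hJbr' _ (hπ x hx).2 y)
    rw [map_sub, LinearMap.sub_apply, map_sub, sub_eq_zero] at this
    exact this.symm
  have hBπ_right : ∀ x ∈ I, ∀ y ∈ I, B x (π y) = B x y := fun x hx y hy => by
    have := (orth _).1 (hπ y hy).2 x hx
    rw [map_sub, sub_eq_zero] at this
    exact this.symm
  have hBπ_left : ∀ x ∈ I, ∀ y ∈ I, B (π x) y = B x y := fun x hx y hy => by
    rw [hBsymm, hBπ_right y hy x hx, hBsymm]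
  refine ⟨fun u hu huv => hdisj u hu ((orth u).2 fun y hy => ?_), ?_, ?_, ?_, ?_, ?_⟩
  · rw [← hBπ_left y hy u (hh u hu), hBsymm]
    exact huv _ (hπ y hy).1
  · have iter : ∀ n : ℕ, ∀ u ∈ h, (fun v : V => π (T v))^[n] u = π ((T ^ n) u) := by
      intro n u hu
      induction n with
      | zero => simpa using (hπh u hu).symm
      | succ n ih =>
        have hmem : (T ^ n) u ∈ I :=
          Module.End.pow_apply_mem_of_forall_mem n hIT u (hh u hu)
        rw [Function.iterate_succ_apply', ih, hπT _ hmem, pow_succ', Module.End.mul_apply]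
    obtain ⟨n, hn⟩ := hnil
    exact ⟨n, fun u hu => by rw [iter n u hu, hn, LinearMap.zero_apply, map_zero]⟩
  · intro u hu v _
    rw [hπT _ (hIbr' u (hh u hu) v), hπbr_left _ (him u), hcent]
  · intro u hu v hv w hw
    rw [hπbr_left _ (him u), hπbr_left _ (him v), hπbr_left _ (him w),
      hπbr_right _ _ (hIbr' v (hh v hv) w), hπbr_right _ _ (hIbr' w (hh w hw) u),
      hπbr_right _ _ (hIbr' u (hh u hu) v), ← map_add, ← map_add, hhomjac, map_zero]
  · intro u hu v hv
    rw [hBπ_left _ (him u) v (hh v hv), hBπ_right u (hh u hu) _ (him v), hBselfadj]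
  · intro u hu v hv w hw
    rw [hBπ_right u (hh u hu) _ (hIbr' v (hh v hv) w),
      hBπ_left _ (hIbr' u (hh u hu) v) w (hh w hw), hBinv]
end

section
/- Let (g,[·,·],T) be a Hom-Lie algebra over F with twist map T in the centroid. If T is injective, then the bracket satisfies the Jacobi identity: [x,[y,z]] + [y,[z,x]] + [z,[x,y]] = 0 for all x,y,z in g; that is, (g,[·,·]) is a Lie algebra. -/
/-- A Hom-Lie algebra with injective twist map in the centroid is a Lie algebra. -/
theorem jacobi_of_injective_twist
    (F : Type*) [Field F] [CharZero F]
    (V : Type*) [AddCommGroup V] [Module F V] [FiniteDimensional F V]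
    (br : V →ₗ[F] V →ₗ[F] V) (T : V →ₗ[F] V)
    (hskew : ∀ x y : V, br x y = - br y x)
    (hhomjac : ∀ x y z : V,
      br (T x) (br y z) + br (T y) (br z x) + br (T z) (br x y) = 0)
    (hcent : ∀ x y : V, T (br x y) = br (T x) y)
    (hinj : Function.Injective T) :
    ∀ x y z : V, br x (br y z) + br y (br z x) + br z (br x y) = 0 := by
  intro x y z
  apply hinj
  rw [map_add, map_add, map_zero, hcent, hcent, hcent]
  exact hhomjac x y z
end

section
/- Let (g,[·,·],T,B) be an indecomposable quadratic Hom-Lie algebra over F with nilpotent twist map T in the centroid and T ≠ 0, and let I be an ideal of g with Ker(T) + Im(T) ⊆ I, I ≠ g, maximal among proper ideals. Then I^⊥ ⊆ I, where I^⊥ is the B-orthogonal complement of I. -/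
/-- In an indecomposable quadratic Hom-Lie algebra with nonzero nilpotent twist map
in the centroid, a maximal proper ideal `I` containing `Ker T + Im T` satisfies
`I^⊥ ⊆ I`. -/
theorem perp_le_maximal_ideal
    (F : Type*) [Field F] [CharZero F]
    (V : Type*) [AddCommGroup V] [Module F V] [FiniteDimensional F V]
    (br : V →ₗ[F] V →ₗ[F] V) (T : V →ₗ[F] V) (B : LinearMap.BilinForm F V)
    (hskew : ∀ x y : V, br x y = - br y x)
    (hhomjac : ∀ x y z : V,
      br (T x) (br y z) + br (T y) (br z x) + br (T z) (br x y) = 0)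
    (hcent : ∀ x y : V, T (br x y) = br (T x) y)
    (hBsymm : ∀ x y : V, B x y = B y x)
    (hBnondeg : ∀ x : V, (∀ y : V, B x y = 0) → x = 0)
    (hBinv : ∀ x y z : V, B x (br y z) = B (br x y) z)
    (hBselfadj : ∀ x y : V, B (T x) y = B x (T y))
    (hnil : ∃ n : ℕ, T ^ n = 0)
    (hTne : T ≠ 0)
    (hind : ∀ J : Submodule F V,
      ((∀ v ∈ J, T v ∈ J) ∧ (∀ x : V, ∀ v ∈ J, br x v ∈ J)) →
      J ≠ ⊥ → J ≠ ⊤ →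
      ¬ (J ⊓ LinearMap.BilinForm.orthogonal B J = ⊥ ∧
          J ⊔ LinearMap.BilinForm.orthogonal B J = ⊤))
    (I : Submodule F V)
    (hI : (∀ v ∈ I, T v ∈ I) ∧ (∀ x : V, ∀ v ∈ I, br x v ∈ I))
    (hker : ∀ x : V, T x = 0 → x ∈ I)
    (him : ∀ x : V, T x ∈ I)
    (hproper : I ≠ ⊤)
    (hmax : ∀ J : Submodule F V,
      ((∀ v ∈ J, T v ∈ J) ∧ (∀ x : V, ∀ v ∈ J, br x v ∈ J)) →
      I ≤ J → J ≠ ⊤ → J = I) :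
    LinearMap.BilinForm.orthogonal B I ≤ I := by
  intro v hv
  refine hker v (hBnondeg _ fun y => ?_)
  rw [hBselfadj, hBsymm]
  exact LinearMap.BilinForm.mem_orthogonal_iff.mp hv (T y) (him y)
end

section
/- Let s = sl(3,F) be the Lie algebra of 3×3 matrices of trace zero over F with bracket [x,y]_s = xy − yx, let K be its Killing form, let s* be its dual space, and let ad*(x)(β)(z) = −β([x,z]_s) be the coadjoint action. Let μ: s × s → s* be any skew-symmetric bilinear map satisfying the cyclic condition μ(x,y)(z) = μ(y,z)(x) for all x,y,z in s. On g = s × s* define the bracket [(x,α),(y,β)] = ([x,y]_s, μ(x,y) + ad*(x)(β) − ad*(y)(α)), the linear map T(x,α) = (0, K(x,·)), and the bilinear form B((x,α),(y,β)) = α(y) + β(x). Then (g,[·,·],T,B) is a quadratic Hom-Lie algebra with twist map T in the centroid: the bracket is bilinear and skew-symmetric, the Hom-Jacobi identity [T(X),[Y,Z]] + [T(Y),[Z,X]] + [T(Z),[X,Y]] = 0 holds for all X,Y,Z in g, T([X,Y]) = [T(X),Y] for all X,Y in g, B is a nondegenerate symmetric bilinear form, B(X,[Y,Z]) = B([X,Y],Z),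 and B(T(X),Y) = B(X,T(Y)). -/
/-- Example: on `g = sl(3,F) × sl(3,F)*`, with bracket
`[(x,α),(y,β)] = ([x,y], μ(x,y) + ad*(x)(β) − ad*(y)(α))` for any cyclic
skew-symmetric bilinear `μ : s × s → s*`, twist map `T(x,α) = (0, K(x,·))` given by
the Killing form `K`, and `B((x,α),(y,β)) = α(y) + β(x)`, one obtains a quadratic
Hom-Lie algebra with twist map `T` in the centroid. -/
theorem sl3_example
    (F : Type*) [Field F] [CharZero F]
    (μ : ↥(LieAlgebra.SpecialLinear.sl (Fin 3) F) →ₗ[F]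
      ↥(LieAlgebra.SpecialLinear.sl (Fin 3) F) →ₗ[F]
      Module.Dual F ↥(LieAlgebra.SpecialLinear.sl (Fin 3) F))
    (hμ_skew : ∀ x y : ↥(LieAlgebra.SpecialLinear.sl (Fin 3) F), μ x y = - μ y x)
    (hμ_cyc : ∀ x y z : ↥(LieAlgebra.SpecialLinear.sl (Fin 3) F), μ x y z = μ y z x)
    (brG : (↥(LieAlgebra.SpecialLinear.sl (Fin 3) F) ×
        Module.Dual F ↥(LieAlgebra.SpecialLinear.sl (Fin 3) F)) →
      (↥(LieAlgebra.SpecialLinear.sl (Fin 3) F) ×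
        Module.Dual F ↥(LieAlgebra.SpecialLinear.sl (Fin 3) F)) →
      (↥(LieAlgebra.SpecialLinear.sl (Fin 3) F) ×
        Module.Dual F ↥(LieAlgebra.SpecialLinear.sl (Fin 3) F)))
    (Tg : (↥(LieAlgebra.SpecialLinear.sl (Fin 3) F) ×
        Module.Dual F ↥(LieAlgebra.SpecialLinear.sl (Fin 3) F)) →
      (↥(LieAlgebra.SpecialLinear.sl (Fin 3) F) ×
        Module.Dual F ↥(LieAlgebra.SpecialLinear.sl (Fin 3) F)))
    (BG : (↥(LieAlgebra.SpecialLinear.sl (Fin 3) F) ×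
        Module.Dual F ↥(LieAlgebra.SpecialLinear.sl (Fin 3) F)) →
      (↥(LieAlgebra.SpecialLinear.sl (Fin 3) F) ×
        Module.Dual F ↥(LieAlgebra.SpecialLinear.sl (Fin 3) F)) → F)
    (hbrG : ∀ (x y : ↥(LieAlgebra.SpecialLinear.sl (Fin 3) F))
        (α β : Module.Dual F ↥(LieAlgebra.SpecialLinear.sl (Fin 3) F)),
      (brG (x, α) (y, β)).1 = ⁅x, y⁆ ∧
      (∀ z : ↥(LieAlgebra.SpecialLinear.sl (Fin 3) F),
        (brG (x, α) (y, β)).2 z = μ x y z - β ⁅x, z⁆ + α ⁅y, z⁆))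
    (hTg : ∀ (x : ↥(LieAlgebra.SpecialLinear.sl (Fin 3) F))
        (α : Module.Dual F ↥(LieAlgebra.SpecialLinear.sl (Fin 3) F)),
      (Tg (x, α)).1 = 0 ∧
      (∀ z : ↥(LieAlgebra.SpecialLinear.sl (Fin 3) F),
        (Tg (x, α)).2 z = killingForm F ↥(LieAlgebra.SpecialLinear.sl (Fin 3) F) x z))
    (hBG : ∀ (x y : ↥(LieAlgebra.SpecialLinear.sl (Fin 3) F))
        (α β : Module.Dual F ↥(LieAlgebra.SpecialLinear.sl (Fin 3) F)),
      BG (x, α) (y, β) = α y + β x) :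
    (∀ X, IsLinearMap F (brG X)) ∧
    (∀ Y, IsLinearMap F (fun X => brG X Y)) ∧
    (∀ X Y, brG X Y = - brG Y X) ∧
    (∀ X Y Z, brG (Tg X) (brG Y Z) + brG (Tg Y) (brG Z X) + brG (Tg Z) (brG X Y) = 0) ∧
    (∀ X Y, Tg (brG X Y) = brG (Tg X) Y) ∧
    IsLinearMap F Tg ∧
    (∀ X, IsLinearMap F (BG X)) ∧
    (∀ Y, IsLinearMap F (fun X => BG X Y)) ∧
    (∀ X Y, BG X Y = BG Y X) ∧
    (∀ X, (∀ Y, BG X Y = 0) → X = 0) ∧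
    (∀ X Y Z, BG X (brG Y Z) = BG (brG X Y) Z) ∧
    (∀ X Y, BG (Tg X) Y = BG X (Tg Y)) := by
  have br_fst (X Y) : (brG X Y).1 = ⁅X.1, Y.1⁆ := (hbrG X.1 Y.1 X.2 Y.2).1
  have br_snd (X Y z) : (brG X Y).2 z = μ X.1 Y.1 z - Y.2 ⁅X.1, z⁆ + X.2 ⁅Y.1, z⁆ :=
    (hbrG X.1 Y.1 X.2 Y.2).2 z
  have T_fst (X) : (Tg X).1 = 0 := (hTg X.1 X.2).1
  have T_snd (X z) : (Tg X).2 z = killingForm F _ X.1 z := (hTg X.1 X.2).2 z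
  have B_apply (X Y) : BG X Y = X.2 Y.1 + Y.2 X.1 := hBG X.1 Y.1 X.2 Y.2
  have K_lie (x y z : LieAlgebra.SpecialLinear.sl (Fin 3) F) :
      killingForm F _ ⁅x, y⁆ z = killingForm F _ x ⁅y, z⁆ :=
    LieModule.traceForm_apply_lie_apply F _ _ x y z
  have K_comm (x y : LieAlgebra.SpecialLinear.sl (Fin 3) F) :
      killingForm F _ x y = killingForm F _ y x :=
    LieModule.traceForm_comm F _ _ x y
  refine ⟨fun X => ⟨fun Y Z => ?_, fun c Y => ?_⟩, fun Y => ⟨fun X Z => ?_, fun c X => ?_⟩,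
    fun X Y => ?_, fun X Y Z => ?_, fun X Y => ?_, ⟨fun X Y => ?_, fun c X => ?_⟩,
    fun X => ⟨fun Y Z => ?_, fun c Y => ?_⟩, fun Y => ⟨fun X Z => ?_, fun c X => ?_⟩,
    fun X Y => ?_, fun X hX => ?_, fun X Y Z => ?_, fun X Y => ?_⟩
  · refine Prod.ext (by simp [br_fst]) (LinearMap.ext fun z => ?_)
    simp only [br_snd, Prod.fst_add, Prod.snd_add, LinearMap.add_apply, map_add, add_lie]
    ring
  · refine Prod.ext (by simp [br_fst]) (LinearMap.ext fun z => ?_)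
    simp only [br_snd, Prod.smul_fst, Prod.smul_snd, LinearMap.smul_apply, map_smul, smul_lie,
      smul_eq_mul]
    ring
  · refine Prod.ext (by simp [br_fst]) (LinearMap.ext fun z => ?_)
    simp only [br_snd, Prod.fst_add, Prod.snd_add, LinearMap.add_apply, map_add, add_lie]
    ring
  · refine Prod.ext (by simp [br_fst]) (LinearMap.ext fun z => ?_)
    simp only [br_snd, Prod.smul_fst, Prod.smul_snd, LinearMap.smul_apply, map_smul, smul_lie,
      smul_eq_mul]
    ring
  · refine Prod.ext (by simp [br_fst]) (LinearMap.ext fun z => ?_)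
    simp only [Prod.snd_neg, LinearMap.neg_apply, br_snd, hμ_skew X.1 Y.1]
    ring
  · refine Prod.ext (by simp [br_fst, T_fst]) (LinearMap.ext fun w => ?_)
    have jacobi := congrArg (fun u => killingForm F _ u w) (lie_jacobi X.1 Y.1 Z.1)
    simp only [map_add, LinearMap.add_apply, map_zero, LinearMap.zero_apply, K_lie] at jacobi
    simpa [br_snd, T_fst, T_snd, br_fst, K_lie] using jacobi
  · refine Prod.ext (by simp [br_fst, T_fst]) (LinearMap.ext fun z => ?_)
    simp [br_snd, T_fst, T_snd, br_fst, K_lie]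
  · exact Prod.ext (by simp [T_fst]) (LinearMap.ext fun z => by simp [T_snd])
  · exact Prod.ext (by simp [T_fst]) (LinearMap.ext fun z => by simp [T_snd])
  · simp only [B_apply, Prod.fst_add, Prod.snd_add, LinearMap.add_apply, map_add]
    ring
  · simp only [B_apply, Prod.smul_fst, Prod.smul_snd, LinearMap.smul_apply, map_smul, smul_eq_mul]
    ring
  · simp only [B_apply, Prod.fst_add, Prod.snd_add, LinearMap.add_apply, map_add]
    ring
  · simp only [B_apply, Prod.smul_fst, Prod.smul_snd, LinearMap.smul_apply, map_smul, smul_eq_mul]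
    ring
  · rw [B_apply, B_apply, add_comm]
  · refine Prod.ext ((Module.forall_dual_apply_eq_zero_iff F X.1).1 fun φ => ?_)
      (LinearMap.ext fun y => ?_)
    · simpa [B_apply] using hX (0, φ)
    · simpa [B_apply] using hX (y, 0)
  · rw [B_apply, B_apply, br_fst, br_fst, br_snd, br_snd, hμ_cyc X.1 Y.1 Z.1,
      ← lie_skew X.1 Y.1, ← lie_skew X.1 Z.1, map_neg, map_neg]
    ring
  · simp [B_apply, T_fst, T_snd, K_comm X.1 Y.1]
end
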